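/- arXiv:0908.2235 — 4 statements merged into one kernel-verified Lean document; each statement's English description precedes it below -/
import Mathlib

section
/- Let b₁, b₂, b₃, b′₁, b′₂, b′₃ : ℝ → ℝ and let x₁, x₂, y₁, y₂ : ℝ → ℝ be differentiable. Define the matrix-valued curve ḡ(t) = !![x₁(t)+i·y₁(t), x₂(t)+i·y₂(t); −x₂(t)+i·y₂(t), x₁(t)−i·y₁(t)]. Then ḡ satisfies the matrix differential equation dḡ/dt = −∑_{k=1}^{3} b′ₖ(t) aₖ ḡ(t) + ∑_{k=1}^{3} bₖ(t) ḡ(t) aₖ for all t if and only if the curve x(t) = (x₁(t), x₂(t), y₁(t), y₂(t)) in ℝ⁴ satisfies the linear system ẋ(t) = M(t) x(t) for all t. -/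
open Matrix Complex

attribute [local instance] Matrix.frobeniusNormedAddCommGroup Matrix.frobeniusNormedSpace

/-- The standard basis of `su(2)` used in the paper. -/
noncomputable def suBasis : Fin 3 → Matrix (Fin 2) (Fin 2) ℂ :=
  ![(1/2 : ℂ) • !![0, I; I, 0],
    (1/2 : ℂ) • !![0, 1; -1, 0],
    (1/2 : ℂ) • !![I, 0; 0, -I]]

/-- The `4×4` coefficient matrix of the linear system relating two equations on `SU(2)`. -/
noncomputable def Mmat (b₁ b₂ b₃ b₁' b₂' b₃' : ℝ → ℝ) (t : ℝ) : Matrix (Fin 4) (Fin 4) ℝ :=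
  (1/2 : ℝ) • !![0,               b₂' t - b₂ t,     b₃' t - b₃ t,    b₁' t - b₁ t;
                 b₂ t - b₂' t,    0,                -b₁ t - b₁' t,   b₃ t + b₃' t;
                 b₃ t - b₃' t,    b₁ t + b₁' t,     0,               -b₂ t - b₂' t;
                 b₁ t - b₁' t,    -b₃ t - b₃' t,    b₂ t + b₂' t,    0]

/-- The curve `ḡ(t)` in `SU(2)` determined by the real functions `x₁, x₂, y₁, y₂`. -/
noncomputable def gbar (x₁ x₂ y₁ y₂ : ℝ → ℝ) (t : ℝ) : Matrix (Fin 2) (Fin 2) ℂ :=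
  !![(x₁ t : ℂ) + (y₁ t : ℂ) * I, (x₂ t : ℂ) + (y₂ t : ℂ) * I;
     -(x₂ t : ℂ) + (y₂ t : ℂ) * I, (x₁ t : ℂ) - (y₁ t : ℂ) * I]

theorem deriv_gbar {x₁ x₂ y₁ y₂ : ℝ → ℝ} {x₁' x₂' y₁' y₂' t : ℝ}
    (hx₁ : HasDerivAt x₁ x₁' t) (hx₂ : HasDerivAt x₂ x₂' t)
    (hy₁ : HasDerivAt y₁ y₁' t) (hy₂ : HasDerivAt y₂ y₂' t) :
    deriv (gbar x₁ x₂ y₁ y₂) t =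
      !![(x₁' : ℂ) + (y₁' : ℂ) * I, (x₂' : ℂ) + (y₂' : ℂ) * I;
         -(x₂' : ℂ) + (y₂' : ℂ) * I, (x₁' : ℂ) - (y₁' : ℂ) * I] := by
  have h := (((hx₁.smul_const (!![1, 0; 0, 1] : Matrix (Fin 2) (Fin 2) ℂ)).add
    (hx₂.smul_const (!![0, 1; -1, 0] : Matrix (Fin 2) (Fin 2) ℂ))).add
    (hy₁.smul_const (!![I, 0; 0, -I] : Matrix (Fin 2) (Fin 2) ℂ))).add
    (hy₂.smul_const (!![0, I; I, 0] : Matrix (Fin 2) (Fin 2) ℂ))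
  have hg : gbar x₁ x₂ y₁ y₂ =
      (fun s => x₁ s • (!![1, 0; 0, 1] : Matrix (Fin 2) (Fin 2) ℂ)) +
      (fun s => x₂ s • (!![0, 1; -1, 0] : Matrix (Fin 2) (Fin 2) ℂ)) +
      (fun s => y₁ s • (!![I, 0; 0, -I] : Matrix (Fin 2) (Fin 2) ℂ)) +
      fun s => y₂ s • (!![0, I; I, 0] : Matrix (Fin 2) (Fin 2) ℂ) := by
    funext s
    ext i j
    fin_cases i <;> fin_cases j <;> simp [gbar, sub_eq_add_neg]
  rw [hg]
  refine h.deriv.trans ?_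
  ext i j
  fin_cases i <;> fin_cases j <;> simp [sub_eq_add_neg]

theorem hasDerivAt_vec_four {f₀ f₁ f₂ f₃ : ℝ → ℝ} {f₀' f₁' f₂' f₃' t : ℝ}
    (h₀ : HasDerivAt f₀ f₀' t) (h₁ : HasDerivAt f₁ f₁' t)
    (h₂ : HasDerivAt f₂ f₂' t) (h₃ : HasDerivAt f₃ f₃' t) :
    HasDerivAt (fun s => ![f₀ s, f₁ s, f₂ s, f₃ s]) ![f₀', f₁', f₂', f₃'] t := by
  rw [hasDerivAt_pi]
  intro i
  fin_cases i <;> simpa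

theorem gbar_ode_iff_linear_system
    (b₁ b₂ b₃ b₁' b₂' b₃' x₁ x₂ y₁ y₂ : ℝ → ℝ)
    (hx₁ : Differentiable ℝ x₁) (hx₂ : Differentiable ℝ x₂)
    (hy₁ : Differentiable ℝ y₁) (hy₂ : Differentiable ℝ y₂) :
    (∀ t, deriv (gbar x₁ x₂ y₁ y₂) t =
        -(b₁' t • (suBasis 0 * gbar x₁ x₂ y₁ y₂ t) +
          b₂' t • (suBasis 1 * gbar x₁ x₂ y₁ y₂ t) +
          b₃' t • (suBasis 2 * gbar x₁ x₂ y₁ y₂ t)) +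
         (b₁ t • (gbar x₁ x₂ y₁ y₂ t * suBasis 0) +
          b₂ t • (gbar x₁ x₂ y₁ y₂ t * suBasis 1) +
          b₃ t • (gbar x₁ x₂ y₁ y₂ t * suBasis 2)))
    ↔ (∀ t, deriv (fun s => ![x₁ s, x₂ s, y₁ s, y₂ s]) t =
        Mmat b₁ b₂ b₃ b₁' b₂' b₃' t *ᵥ ![x₁ t, x₂ t, y₁ t, y₂ t]) := by
  refine forall_congr' fun t => ?_
  rw [deriv_gbar (hx₁ t).hasDerivAt (hx₂ t).hasDerivAt
      (hy₁ t).hasDerivAt (hy₂ t).hasDerivAt,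
    (hasDerivAt_vec_four (hx₁ t).hasDerivAt (hx₂ t).hasDerivAt
      (hy₁ t).hasDerivAt (hy₂ t).hasDerivAt).deriv]
  simp only [← Matrix.ext_iff, funext_iff, Fin.forall_fin_succ, Complex.ext_iff]
  simp [gbar, suBasis, Mmat, Matrix.mulVec, dotProduct, Fin.sum_univ_succ]
  constructor
  · rintro ⟨⟨⟨h1, h2⟩, h3, h4⟩, -⟩
    refine ⟨?_, ?_, ?_, ?_⟩ <;> linarith
  · rintro ⟨h1, h2, h3, h4⟩
    refine ⟨⟨⟨?_, ?_⟩, ?_, ?_⟩, ⟨?_, ?_⟩, ?_, ?_⟩ <;> linarith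
end

section
/- For any continuous functions b₁, b₂, b₃, b′₁, b′₂, b′₃ : ℝ → ℝ there exists a differentiable curve ḡ : ℝ → Matrix (2×2, ℂ) with ḡ(0) = I, satisfying dḡ/dt = −∑_{k=1}^{3} b′ₖ(t) aₖ ḡ(t) + ∑_{k=1}^{3} bₖ(t) ḡ(t) aₖ for all t, and such that ḡ(t) lies in SU(2) (i.e. ḡ(t)ᴴ ḡ(t) = I and det ḡ(t) = 1) for all t. In other words, any two equations in SU(2) determined by curves a(t) = −∑ bₖ(t) aₖ and a′(t) = −∑ b′ₖ(t) aₖ in su(2) are always related by some curve in SU(2). -/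
open Matrix Complex

attribute [local instance] Matrix.frobeniusNormedAddCommGroup Matrix.frobeniusNormedSpace

open scoped Quaternion RealInnerProductSpace NNReal

theorem norm_eq_of_hasDerivWithinAt_of_inner_eq_zero {E : Type*} [NormedAddCommGroup E]
    [InnerProductSpace ℝ E] {s : Set ℝ} (hs : Convex ℝ s) {v v' : ℝ → E}
    (hv : ∀ t ∈ s, HasDerivWithinAt v (v' t) s t) (hvv' : ∀ t ∈ s, ⟪v t, v' t⟫ = 0)
    {t₀ t : ℝ} (ht₀ : t₀ ∈ s) (ht : t ∈ s) : ‖v t‖ = ‖v t₀‖ := by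
  have hd : ∀ t ∈ s, HasDerivWithinAt (fun t ↦ ‖v t‖ ^ 2) 0 s t := fun t ht ↦ by
    simpa [hvv' t ht] using (hv t ht).norm_sq
  have h := hs.norm_image_sub_le_of_norm_hasDerivWithin_le (C := 0) hd (by simp) ht₀ ht
  rw [zero_mul, norm_le_zero_iff, sub_eq_zero] at h
  exact (pow_left_inj₀ (norm_nonneg _) (norm_nonneg _) two_ne_zero).1 h

section SkewLinearODE

variable {E : Type*} [NormedAddCommGroup E] [InnerProductSpace ℝ E] [FiniteDimensional ℝ E]
  {A : ℝ → E →L[ℝ] E}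

/-- The vector field is multiplied by a cutoff function to make it bounded. Solutions of the
resulting equation have constant norm, so they never meet the region affected by the cutoff. -/
theorem exists_forall_mem_Icc_hasDerivWithinAt_of_skew (hA : Continuous A)
    (hskew : ∀ t x, ⟪x, A t x⟫ = 0) (x₀ : E) {T : ℝ} (hT : 0 ≤ T) :
    ∃ x : ℝ → E, x 0 = x₀ ∧
      ∀ t ∈ Set.Icc (-T) T, HasDerivWithinAt x (A t (x t)) (Set.Icc (-T) T) t := by
  let φ : ContDiffBump (0 : E) := ⟨‖x₀‖ + 1, ‖x₀‖ + 2, by positivity, by linarith⟩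
  let ψ : E → E := fun x ↦ φ x • x
  have hψ : ContDiff ℝ 1 ψ := φ.contDiff.smul contDiff_id
  have hψc : HasCompactSupport ψ := φ.hasCompactSupport.smul_right
  obtain ⟨K, hK⟩ : ∃ K, LipschitzWith K ψ :=
    hψ.lipschitzWith_of_hasCompactSupport hψc one_ne_zero
  obtain ⟨B, hB⟩ := hψc.exists_bound_of_continuous hψ.continuous
  obtain ⟨M, hM⟩ := isCompact_Icc.exists_bound_of_continuousOn (s := Set.Icc (-T) T)
    hA.continuousOn
  have h0 : (0 : ℝ) ∈ Set.Icc (-T) T := ⟨by linarith, hT⟩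
  lift B to ℝ≥0 using (norm_nonneg _).trans (hB 0)
  lift M to ℝ≥0 using (norm_nonneg _).trans (hM 0 h0)
  lift T to ℝ≥0 using hT
  have hPL : IsPicardLindelof (fun t x ↦ A t (ψ x)) (⟨0, h0⟩ : Set.Icc (-T : ℝ) T) x₀
      (M * B * T) 0 (M * B) (M * K) :=
    { lipschitzOnWith := fun t ht ↦
        (((A t).lipschitz.weaken (hM t ht)).comp hK).lipschitzOnWith
      continuousOn := fun x _ ↦ (hA.clm_apply continuous_const).continuousOn
      norm_le := fun t ht x _ ↦ by
        push_cast
        exact (A t).le_of_opNorm_le_of_le (hM t ht) (hB x)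
      mul_max_le := by simp }
  obtain ⟨x, hx0, hx⟩ := hPL.exists_eq_forall_mem_Icc_hasDerivWithinAt₀
  refine ⟨x, hx0, fun t ht ↦ ?_⟩
  have hnorm : ‖x t‖ = ‖x 0‖ := norm_eq_of_hasDerivWithinAt_of_inner_eq_zero (convex_Icc _ _) hx
    (fun t _ ↦ by simp [ψ, inner_smul_right, hskew]) h0 ht
  have hφ : φ (x t) = 1 := φ.one_of_mem_closedBall <| by
    have : x 0 = x₀ := hx0
    simp [φ, hnorm, this]
  simpa [ψ, hφ] using hx t ht

theorem exists_forall_hasDerivAt_of_skew (hA : Continuous A)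
    (hskew : ∀ t x, ⟪x, A t x⟫ = 0) (x₀ : E) :
    ∃ x : ℝ → E, x 0 = x₀ ∧ ∀ t, HasDerivAt x (A t (x t)) t := by
  choose y hy0 hy using fun n : ℕ ↦
    exists_forall_mem_Icc_hasDerivWithinAt_of_skew hA hskew x₀ n.cast_nonneg
  have hmono : ∀ {m n : ℕ}, m ≤ n → ∀ t ∈ Set.Icc (-m : ℝ) m, y n t = y m t := by
    intro m n hmn t ht
    have hsub : Set.Icc (-m : ℝ) m ⊆ Set.Icc (-n : ℝ) n := by
      have : (m : ℝ) ≤ n := by exact_mod_cast hmn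
      exact Set.Icc_subset_Icc (by linarith) this
    have h := norm_eq_of_hasDerivWithinAt_of_inner_eq_zero (convex_Icc _ _)
      (fun t ht ↦ ((hy n t (hsub ht)).mono hsub).sub (hy m t ht))
      (fun t _ ↦ by simpa using hskew t (y n t - y m t))
      (t₀ := 0) (by simp) ht
    simpa [hy0, sub_eq_zero] using h
  have heq : ∀ (n : ℕ), ∀ t ∈ Set.Icc (-n : ℝ) n, y ⌈|t|⌉₊ t = y n t := fun n t ht ↦
    (hmono (Nat.ceil_le.2 (abs_le.2 ht)) t (abs_le.1 (Nat.le_ceil _))).symm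
  refine ⟨fun t ↦ y ⌈|t|⌉₊ t, by simp [hy0], fun t ↦ ?_⟩
  obtain ⟨n, hn⟩ := exists_nat_gt |t|
  have hnhds : Set.Icc (-n : ℝ) n ∈ nhds t := Icc_mem_nhds (abs_lt.1 hn).1 (abs_lt.1 hn).2
  have ht := mem_of_mem_nhds hnhds
  have h := ((hy n t ht).hasDerivAt hnhds).congr_of_eventuallyEq
    (Filter.eventually_of_mem hnhds (heq n))
  simpa only [heq n t ht] using h

end SkewLinearODE

/-- The standard embedding of the quaternions into the complex `2 × 2` matrices, under which the
unit quaternions correspond to `SU(2)`. -/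
noncomputable def quaternionToMatrix : ℍ[ℝ] →ₗ[ℝ] Matrix (Fin 2) (Fin 2) ℂ where
  toFun q := !![⟨q.re, q.imI⟩, ⟨q.imJ, q.imK⟩; ⟨-q.imJ, q.imK⟩, ⟨q.re, -q.imI⟩]
  map_add' p q := by
    ext i j
    fin_cases i <;> fin_cases j <;> simp [Complex.ext_iff, add_comm]
  map_smul' c q := by
    ext i j
    fin_cases i <;> fin_cases j <;> simp [Complex.ext_iff]

theorem quaternionToMatrix_apply (q : ℍ[ℝ]) : quaternionToMatrix q =
    !![⟨q.re, q.imI⟩, ⟨q.imJ, q.imK⟩; ⟨-q.imJ, q.imK⟩, ⟨q.re, -q.imI⟩] := rfl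

theorem quaternionToMatrix_one : quaternionToMatrix 1 = 1 := by
  ext i j
  fin_cases i <;> fin_cases j <;> simp [quaternionToMatrix_apply, Complex.ext_iff]

theorem quaternionToMatrix_mul (p q : ℍ[ℝ]) :
    quaternionToMatrix (p * q) = quaternionToMatrix p * quaternionToMatrix q := by
  ext i j
  fin_cases i <;> fin_cases j <;>
    simp [quaternionToMatrix_apply, Complex.ext_iff, Matrix.mul_apply, Fin.sum_univ_two] <;>
    constructor <;> ring

theorem quaternionToMatrix_star (q : ℍ[ℝ]) :
    quaternionToMatrix (star q) = (quaternionToMatrix q)ᴴ := by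
  ext i j
  fin_cases i <;> fin_cases j <;> simp [quaternionToMatrix_apply, Complex.ext_iff]

theorem det_quaternionToMatrix (q : ℍ[ℝ]) :
    (quaternionToMatrix q).det = (Quaternion.normSq q : ℝ) := by
  simp [quaternionToMatrix_apply, Matrix.det_fin_two_of, Complex.ext_iff, Quaternion.normSq_def',
    -Complex.ofReal_add, -Complex.ofReal_pow]
  constructor <;> ring

/-- The purely imaginary quaternion corresponding to `c₁ a₁ + c₂ a₂ + c₃ a₃ ∈ su(2)`. -/
noncomputable def suQuaternion (c₁ c₂ c₃ : ℝ) : ℍ[ℝ] :=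
  ⟨0, c₃ / 2, c₂ / 2, c₁ / 2⟩

@[simp] theorem suQuaternion_re (c₁ c₂ c₃ : ℝ) : (suQuaternion c₁ c₂ c₃).re = 0 := rfl

@[simp] theorem suQuaternion_imI (c₁ c₂ c₃ : ℝ) : (suQuaternion c₁ c₂ c₃).imI = c₃ / 2 := rfl

@[simp] theorem suQuaternion_imJ (c₁ c₂ c₃ : ℝ) : (suQuaternion c₁ c₂ c₃).imJ = c₂ / 2 := rfl

@[simp] theorem suQuaternion_imK (c₁ c₂ c₃ : ℝ) : (suQuaternion c₁ c₂ c₃).imK = c₁ / 2 := rfl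

theorem Continuous.suQuaternion {X : Type*} [TopologicalSpace X] {c₁ c₂ c₃ : X → ℝ}
    (h₁ : Continuous c₁) (h₂ : Continuous c₂) (h₃ : Continuous c₃) :
    Continuous fun t ↦ suQuaternion (c₁ t) (c₂ t) (c₃ t) := by
  refine (Quaternion.linearIsometryEquivTuple.symm.continuous.comp <|
    (PiLp.continuous_toLp 2 _).comp (f := fun t ↦ ![0, c₃ t / 2, c₂ t / 2, c₁ t / 2]) ?_)
  fun_prop

theorem quaternionToMatrix_suQuaternion (c₁ c₂ c₃ : ℝ) :
    quaternionToMatrix (suQuaternion c₁ c₂ c₃) =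
      c₁ • suBasis 0 + c₂ • suBasis 1 + c₃ • suBasis 2 := by
  ext i j
  fin_cases i <;> fin_cases j <;>
    simp [quaternionToMatrix_apply, suBasis, Complex.ext_iff, div_eq_mul_inv]

theorem inner_suQuaternion_mul_self (c₁ c₂ c₃ : ℝ) (x : ℍ[ℝ]) :
    ⟪x, suQuaternion c₁ c₂ c₃ * x⟫ = 0 := by
  simp [Quaternion.inner_def]
  ring

theorem inner_self_mul_suQuaternion (c₁ c₂ c₃ : ℝ) (x : ℍ[ℝ]) :
    ⟪x, x * suQuaternion c₁ c₂ c₃⟫ = 0 := by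
  simp [Quaternion.inner_def]
  ring

theorem exists_SU2_curve_relating_two_equations
    (b₁ b₂ b₃ b₁' b₂' b₃' : ℝ → ℝ)
    (hb₁ : Continuous b₁) (hb₂ : Continuous b₂) (hb₃ : Continuous b₃)
    (hb₁' : Continuous b₁') (hb₂' : Continuous b₂') (hb₃' : Continuous b₃') :
    ∃ g : ℝ → Matrix (Fin 2) (Fin 2) ℂ,
      g 0 = 1 ∧ Differentiable ℝ g ∧
      (∀ t, deriv g t =
        -(b₁' t • (suBasis 0 * g t) + b₂' t • (suBasis 1 * g t) + b₃' t • (suBasis 2 * g t)) +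
         (b₁ t • (g t * suBasis 0) + b₂ t • (g t * suBasis 1) + b₃ t • (g t * suBasis 2))) ∧
      (∀ t, (g t)ᴴ * g t = 1 ∧ (g t).det = 1) := by
  let u : ℝ → ℍ[ℝ] := fun t ↦ suQuaternion (b₁ t) (b₂ t) (b₃ t)
  let u' : ℝ → ℍ[ℝ] := fun t ↦ suQuaternion (b₁' t) (b₂' t) (b₃' t)
  have hu : Continuous u := hb₁.suQuaternion hb₂ hb₃
  have hu' : Continuous u' := hb₁'.suQuaternion hb₂' hb₃'
  let A : ℝ → ℍ[ℝ] →L[ℝ] ℍ[ℝ] := fun t ↦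
    -ContinuousLinearMap.mul ℝ ℍ[ℝ] (u' t) + (ContinuousLinearMap.mul ℝ ℍ[ℝ]).flip (u t)
  have hA : Continuous A := by fun_prop
  have hskew : ∀ t x, ⟪x, A t x⟫ = 0 := fun t x ↦ by
    simp [A, u, u', inner_add_right, inner_suQuaternion_mul_self, inner_self_mul_suQuaternion]
  obtain ⟨x, hx0, hx⟩ := exists_forall_hasDerivAt_of_skew hA hskew 1
  have hnorm : ∀ t, Quaternion.normSq (x t) = 1 := fun t ↦ by
    have h := norm_eq_of_hasDerivWithinAt_of_inner_eq_zero convex_univ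
      (fun t _ ↦ (hx t).hasDerivWithinAt) (fun t _ ↦ hskew t (x t))
      (Set.mem_univ 0) (Set.mem_univ t)
    simp [Quaternion.normSq_eq_norm_mul_self, h, hx0]
  have hg : ∀ t, HasDerivAt (fun t ↦ quaternionToMatrix (x t))
      (quaternionToMatrix (A t (x t))) t := fun t ↦
    (LinearMap.toContinuousLinearMap quaternionToMatrix).hasFDerivAt.comp_hasDerivAt t (hx t)
  refine ⟨fun t ↦ quaternionToMatrix (x t), by simp [hx0, quaternionToMatrix_one],
    fun t ↦ (hg t).differentiableAt, fun t ↦ ?_, fun t ↦ ⟨?_, ?_⟩⟩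
  · refine (hg t).deriv.trans ?_
    simp [A, u, u', quaternionToMatrix_mul, quaternionToMatrix_suQuaternion, add_mul, mul_add]
  · rw [← quaternionToMatrix_star, ← quaternionToMatrix_mul, Quaternion.star_mul_self, hnorm,
      Quaternion.coe_one, quaternionToMatrix_one]
  · rw [det_quaternionToMatrix, hnorm, Complex.ofReal_one]
end

section
/- Let B, θ, φ : ℝ → ℝ be differentiable functions, and let γ ∈ ℝ with sin γ ≠ 0 and cos(γ/2) ≠ 0. Define b₁(t) = B(t) sin θ(t) cos φ(t), b₂(t) = B(t) sin θ(t) sin φ(t), b₃(t) = B(t) cos θ(t), and D(t) = B(t) cos(γ/2 + θ(t)) / cos(γ/2), and take b′₁ = b′₂ = 0, b′₃ = D in the matrix M(t). If the integrability condition φ̇(t) = B(t) sin(θ(t) + γ)/sin γ holds for all t, then the curve x(t) = (cos(γ/2), −sin(γ/2) cos φ(t), 0, sin(γ/2) sin φ(t)) in ℝ⁴ satisfies ẋ(t) = M(t) x(t) for all t. -/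
open Matrix

theorem integrability_condition_gives_solution
    (B θ φ : ℝ → ℝ) (hB : Differentiable ℝ B) (hθ : Differentiable ℝ θ)
    (hφ : Differentiable ℝ φ) (γ : ℝ) (hγ : Real.sin γ ≠ 0) (hγ2 : Real.cos (γ/2) ≠ 0)
    (b₁ : ℝ → ℝ) (hb₁ : b₁ = fun t => B t * Real.sin (θ t) * Real.cos (φ t))
    (b₂ : ℝ → ℝ) (hb₂ : b₂ = fun t => B t * Real.sin (θ t) * Real.sin (φ t))
    (b₃ : ℝ → ℝ) (hb₃ : b₃ = fun t => B t * Real.cos (θ t))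
    (D : ℝ → ℝ) (hD : D = fun t => B t * Real.cos (γ/2 + θ t) / Real.cos (γ/2))
    (hint : ∀ t, deriv φ t = B t * Real.sin (θ t + γ) / Real.sin γ) :
    ∀ t, deriv (fun s => ![Real.cos (γ/2), -Real.sin (γ/2) * Real.cos (φ s), 0,
                           Real.sin (γ/2) * Real.sin (φ s)]) t =
      Mmat b₁ b₂ b₃ 0 0 D t *ᵥ
        ![Real.cos (γ/2), -Real.sin (γ/2) * Real.cos (φ t), 0,
          Real.sin (γ/2) * Real.sin (φ t)] := by
  intro t
  have hs : Real.sin (γ/2) ≠ 0 := by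
    rintro h
    apply hγ
    rw [show γ = 2 * (γ/2) by ring, Real.sin_two_mul, h]
    ring
  have hφt := (hφ t).hasDerivAt
  have hx : HasDerivAt (fun s => ![Real.cos (γ/2), -Real.sin (γ/2) * Real.cos (φ s), 0,
        Real.sin (γ/2) * Real.sin (φ s)])
      ![0, -Real.sin (γ/2) * (-Real.sin (φ t) * deriv φ t), 0,
        Real.sin (γ/2) * (Real.cos (φ t) * deriv φ t)] t := by
    rw [hasDerivAt_pi]
    intro i
    fin_cases i
    · exact hasDerivAt_const t _
    · exact hφt.cos.const_mul _
    · exact hasDerivAt_const t _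
    · exact hφt.sin.const_mul _
  have hφ' : Real.sin (γ/2) * deriv φ t =
      (B t * Real.sin (θ t) * Real.cos (γ/2) +
        (B t * Real.cos (θ t) + D t) * Real.sin (γ/2)) / 2 := by
    have hsin : Real.sin γ = 2 * Real.sin (γ/2) * Real.cos (γ/2) := by
      rw [← Real.sin_two_mul]; ring_nf
    have hcos : Real.cos γ = Real.cos (γ/2) ^ 2 - Real.sin (γ/2) ^ 2 := by
      rw [← Real.cos_two_mul']; ring_nf
    simp only [hint t, hD, Real.sin_add, Real.cos_add, hsin, hcos]
    field_simp
    ring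
  have hDt : D t * Real.cos (γ/2) =
      B t * (Real.cos (γ/2) * Real.cos (θ t) - Real.sin (γ/2) * Real.sin (θ t)) := by
    rw [hD, ← Real.cos_add]
    field_simp
  rw [hx.deriv]
  ext i
  fin_cases i <;> simp [Mmat, Matrix.mulVec, dotProduct, Fin.sum_univ_four, hb₁, hb₂, hb₃]
  · ring
  · linear_combination Real.sin (φ t) * hφ'
  · linear_combination (1/2) * hDt +
      (1/2) * B t * Real.sin (θ t) * Real.sin (γ/2) * Real.sin_sq_add_cos_sq (φ t)
  · linear_combination Real.cos (φ t) * hφ'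
end

section
/- Let B, θ, ω, γ ∈ ℝ with sin γ ≠ 0 and cos(γ/2) ≠ 0, and suppose ω sin γ = B sin(θ + γ). Define D = B cos(γ/2 + θ)/cos(γ/2). Then (D − ω)² = ω² − 2ωB cos θ + B², i.e. D = ω ± √(ω² − 2ωB cos θ + B²). -/
theorem D_value_formula (B θ ω γ : ℝ) (hγ : Real.sin γ ≠ 0) (hγ2 : Real.cos (γ/2) ≠ 0)
    (hint : ω * Real.sin γ = B * Real.sin (θ + γ))
    (D : ℝ) (hD : D = B * Real.cos (γ/2 + θ) / Real.cos (γ/2)) :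
    (D - ω)^2 = ω^2 - 2*ω*B*Real.cos θ + B^2 ∧
      (D = ω + Real.sqrt (ω^2 - 2*ω*B*Real.cos θ + B^2) ∨
       D = ω - Real.sqrt (ω^2 - 2*ω*B*Real.cos θ + B^2)) := by
  have hsin : Real.sin γ = 2 * Real.sin (γ/2) * Real.cos (γ/2) := by
    rw [← Real.sin_two_mul, mul_div_cancel₀ γ two_ne_zero]
  have hcos : Real.cos γ = Real.cos (γ/2) ^ 2 - Real.sin (γ/2) ^ 2 := by
    rw [← Real.cos_two_mul', mul_div_cancel₀ γ two_ne_zero]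
  rw [Real.sin_add, hsin, hcos] at hint
  rw [eq_div_iff hγ2, Real.cos_add] at hD
  have hsq : (D - ω)^2 = ω^2 - 2*ω*B*Real.cos θ + B^2 := by
    apply mul_left_cancel₀ (pow_ne_zero 2 hγ2)
    linear_combination
      (D * Real.cos (γ/2)
        + B * (Real.cos (γ/2) * Real.cos θ - Real.sin (γ/2) * Real.sin θ)
        - 2 * ω * Real.cos (γ/2)) * hD
      + B * Real.sin θ * hint
      + B^2 * Real.cos (γ/2)^2 * Real.sin_sq_add_cos_sq θ
  refine ⟨hsq, ?_⟩
  rw [← hsq, Real.sqrt_sq_eq_abs]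
  rcases abs_choice (D - ω) with h | h <;> rw [h]
  · left; ring
  · right; ring
end
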